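/- Let μ be a probability mass function on Fin J, let d : Fin J → ℝ be the disturbance values, let N ≥ 1, and equip Ω = (Fin N → Fin J) with the i.i.d. product pmf P(ω) = ∏_{i} μ(ω i). Let a : Fin N → ℝ and β ∈ (0,1). Then CVaR_{1−β} under P of the random variable ω ↦ ∑ i, a i · d (ω i) is at most (∑ i, |a i|) · CVaR_{1−β} under μ of the random variable j ↦ |d j|. (This is the further constraint tightening (12) obtained from monotonicity, positive homogeneity, subadditivity of CVaR and the i.i.d. assumption on the disturbances.) -/

import Mathlib

open Finset

/-- `CVaR p C β` is CVaR_{1−β} of the cost `C` under the pmf `p` on a finite type. -/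
noncomputable def CVaR {T : Type*} [Fintype T] (p C : T → ℝ) (β : ℝ) : ℝ :=
  ⨅ z : ℝ, z + (1 / (1 - β)) * ∑ t, p t * max (C t - z) 0

theorem sum_pi_prod_eq_one {ι κ : Type*} [Fintype ι] [DecidableEq ι] [Fintype κ]
    (μ : κ → ℝ) (hμ1 : ∑ j, μ j = 1) : ∑ ω : ι → κ, ∏ i, μ (ω i) = 1 := by
  rw [← Fintype.prod_sum fun _ => μ]
  simp [hμ1]

/-- Expectations of a function of one coordinate under the i.i.d. product pmf. -/
theorem sum_pi_prod_mul {ι κ : Type*} [Fintype ι] [DecidableEq ι] [Fintype κ]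
    (μ : κ → ℝ) (hμ1 : ∑ j, μ j = 1) (f : κ → ℝ) (i : ι) :
    ∑ ω : ι → κ, (∏ k, μ (ω k)) * f (ω i) = ∑ j, μ j * f j := by
  have h (ω : ι → κ) : (∏ k, μ (ω k)) * f (ω i) =
      ∏ k, μ (ω k) * (if k = i then f (ω k) else 1) := by
    rw [Finset.prod_mul_distrib]
    simp
  simp_rw [h]
  rw [← Fintype.prod_sum fun k j => μ j * (if k = i then f j else 1),
    Fintype.prod_eq_single i]
  · simp
  · intro k hk
    simp [hk, hμ1]

theorem bddBelow_range_CVaR {T : Type*} [Fintype T] {p : T → ℝ} (C : T → ℝ) {β : ℝ}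
    (hp0 : ∀ t, 0 ≤ p t) (hp1 : ∑ t, p t = 1) (hβ : β ∈ Set.Ioo (0 : ℝ) 1) :
    BddBelow (Set.range fun z : ℝ => z + (1 / (1 - β)) * ∑ t, p t * max (C t - z) 0) := by
  refine ⟨∑ t, p t * C t, ?_⟩
  rintro _ ⟨z, rfl⟩
  have h0 : 0 ≤ ∑ t, p t * max (C t - z) 0 :=
    Finset.sum_nonneg fun t _ => mul_nonneg (hp0 t) (le_max_right _ _)
  have h1 : ∑ t, p t * (C t - z) ≤ ∑ t, p t * max (C t - z) 0 :=
    Finset.sum_le_sum fun t _ => mul_le_mul_of_nonneg_left (le_max_left _ _) (hp0 t)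
  have h2 : ∑ t, p t * (C t - z) = ∑ t, p t * C t - z := by
    simp [mul_sub, Finset.sum_sub_distrib, ← Finset.sum_mul, hp1]
  have hk : 1 ≤ 1 / (1 - β) := by
    rw [le_div_iff₀] <;> linarith [hβ.1, hβ.2]
  have h3 := le_mul_of_one_le_left h0 hk
  dsimp only
  linarith

theorem max_sum_mul_sub_le {ι : Type*} [Fintype ι] (a x : ι → ℝ) (z : ℝ) :
    max (∑ i, a i * x i - (∑ i, |a i|) * z) 0 ≤ ∑ i, |a i| * max (|x i| - z) 0 := by
  refine max_le ?_ (Finset.sum_nonneg fun i _ => by positivity)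
  rw [Finset.sum_mul, ← Finset.sum_sub_distrib]
  refine Finset.sum_le_sum fun i _ => ?_
  calc a i * x i - |a i| * z ≤ |a i| * (|x i| - z) := by
        rw [mul_sub, ← abs_mul]
        gcongr
        exact le_abs_self _
    _ ≤ |a i| * max (|x i| - z) 0 := by
        gcongr
        exact le_max_left _ _

/-- the further tightening (12) via the i.i.d. product distribution. -/
theorem cvar_iid_tightening (J N : ℕ) (hN : 1 ≤ N)
    (μ : Fin J → ℝ) (hμ0 : ∀ j, 0 ≤ μ j) (hμ1 : ∑ j, μ j = 1)
    (d : Fin J → ℝ) (a : Fin N → ℝ) (β : ℝ)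
    (hβ : β ∈ Set.Ioo (0 : ℝ) 1) :
    CVaR (fun ω : Fin N → Fin J => ∏ i, μ (ω i))
        (fun ω => ∑ i, a i * d (ω i)) β ≤
      (∑ i, |a i|) * CVaR μ (fun j => |d j|) β := by
  have hP0 (ω : Fin N → Fin J) : 0 ≤ ∏ i, μ (ω i) := Finset.prod_nonneg fun i _ => hμ0 _
  have hk : 0 ≤ 1 / (1 - β) := one_div_nonneg.2 (by linarith [hβ.2])
  unfold CVaR
  rw [Real.mul_iInf_of_nonneg (Finset.sum_nonneg fun i _ => abs_nonneg (a i))]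
  refine le_ciInf fun z => ?_
  refine (ciInf_le (bddBelow_range_CVaR _ hP0 (sum_pi_prod_eq_one μ hμ1) hβ)
    ((∑ i, |a i|) * z)).trans ?_
  have key : ∑ ω : Fin N → Fin J, (∏ i, μ (ω i)) *
      max (∑ i, a i * d (ω i) - (∑ i, |a i|) * z) 0 ≤
      (∑ i, |a i|) * ∑ j, μ j * max (|d j| - z) 0 := by
    calc _ ≤ ∑ ω : Fin N → Fin J, (∏ i, μ (ω i)) *
          ∑ i, |a i| * max (|d (ω i)| - z) 0 :=
          Finset.sum_le_sum fun ω _ =>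
            mul_le_mul_of_nonneg_left (max_sum_mul_sub_le a (fun i => d (ω i)) z) (hP0 ω)
      _ = ∑ i, |a i| * ∑ ω : Fin N → Fin J, (∏ k, μ (ω k)) * max (|d (ω i)| - z) 0 := by
          simp_rw [Finset.mul_sum]
          rw [Finset.sum_comm]
          simp_rw [mul_left_comm]
      _ = _ := by
          simp_rw [sum_pi_prod_mul μ hμ1 fun j => max (|d j| - z) 0]
          rw [Finset.sum_mul]
  rw [mul_add, mul_left_comm]
  gcongr
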